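/- Let R be a commutative ring, let c be a natural number, and for each v ∈ {0,1}^c let C_v be an R-module. Suppose given R-linear maps m_{vu} : C_v → C_u for every pair v ≥ u, satisfying: for every pair w ≥ u in {0,1}^c, Σ_{v : w ≥ v ≥ u} (−1)^{|v−u|₁·(|w−v|₁−1)+1} (m_{vu} ∘ m_{wv}) = 0. Define f_{vu} := (−1)^{|v−u|₁(|v−u|₁−1)/2 + Σ_i v_i} · m_{vu}. Then for every pair w ≥ u, Σ_{v : w ≥ v ≥ u} f_{vu} ∘ f_{wv} = 0; consequently the endomorphism F := Σ_{v ≥ u} f_{vu} of the direct sum ⊕_{v ∈ {0,1}^c} C_v (where f_{vu} is regarded as a map from the v-summand to the u-summand) satisfies F ∘ F = 0, i.e. (⊕_v C_v, F) is a chain complex. -/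

import Mathlib

open Finset
open scoped DirectSum Classical

/-- The L¹ distance `|v - u|₁ = ∑ i |vᵢ - uᵢ|` between two vertices of the cube `{0,1}^c`. -/
def cubeL1 {c : ℕ} (v u : Fin c → Fin 2) : ℤ := ∑ i, |(v i : ℤ) - (u i : ℤ)|

/-- The sum of coordinates `∑ i vᵢ` of a vertex of the cube `{0,1}^c`. -/
def cubeSum {c : ℕ} (v : Fin c → Fin 2) : ℤ := ∑ i, (v i : ℤ)

/-- The map `f_{vu} := (−1)^{|v−u|₁(|v−u|₁−1)/2 + Σᵢ vᵢ} · m_{vu}`. -/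
def cubeF {R : Type*} [CommRing R] {c : ℕ} {C : (Fin c → Fin 2) → Type*}
    [∀ v, AddCommGroup (C v)] [∀ v, Module R (C v)]
    (m : ∀ v u : Fin c → Fin 2, C v →ₗ[R] C u) (v u : Fin c → Fin 2) :
    C v →ₗ[R] C u :=
  (((Int.negOnePow (cubeL1 v u * (cubeL1 v u - 1) / 2 + cubeSum v) : ℤˣ) : ℤ) : R) • m v u

/-- The total endomorphism `F := Σ_{v ≥ u} f_{vu}` of the direct sum `⊕_{v} C_v`,
where `f_{vu}` is regarded as a map from the `v`-summand to the `u`-summand. -/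
noncomputable def cubeTotal {R : Type*} [CommRing R] {c : ℕ} {C : (Fin c → Fin 2) → Type*}
    [∀ v, AddCommGroup (C v)] [∀ v, Module R (C v)]
    (m : ∀ v u : Fin c → Fin 2, C v →ₗ[R] C u) :
    (⨁ v, C v) →ₗ[R] (⨁ v, C v) :=
  ∑ p ∈ univ.filter (fun p : (Fin c → Fin 2) × (Fin c → Fin 2) => p.2 ≤ p.1),
    (DirectSum.lof R _ C p.2).comp ((cubeF m p.1 p.2).comp (DirectSum.component R _ C p.1))

theorem cubeL1_eq_sub_of_le {c : ℕ} {v u : Fin c → Fin 2} (h : u ≤ v) :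
    cubeL1 v u = cubeSum v - cubeSum u := by
  simp only [cubeL1, cubeSum, ← Finset.sum_sub_distrib]
  refine Finset.sum_congr rfl fun i _ => abs_of_nonneg (sub_nonneg.mpr ?_)
  exact_mod_cast h i

theorem Int.triangular_add (a b : ℤ) :
    (a + b) * (a + b - 1) / 2 = a * (a - 1) / 2 + b * (b - 1) / 2 + a * b := by
  obtain ⟨x, hx⟩ := Int.even_mul_pred_self a
  obtain ⟨y, hy⟩ := Int.even_mul_pred_self b
  have hab : (a + b) * (a + b - 1) = a * (a - 1) + b * (b - 1) + 2 * (a * b) := by ring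
  rw [hab, hx, hy]
  omega

theorem cubeF_comp_cubeF {R : Type*} [CommRing R] {c : ℕ} {C : (Fin c → Fin 2) → Type*}
    [∀ v, AddCommGroup (C v)] [∀ v, Module R (C v)]
    (m : ∀ v u : Fin c → Fin 2, C v →ₗ[R] C u) {w v u : Fin c → Fin 2}
    (huv : u ≤ v) (hvw : v ≤ w) :
    (cubeF m v u).comp (cubeF m w v) =
      (((Int.negOnePow (cubeL1 w u * (cubeL1 w u - 1) / 2 + cubeL1 w u - 1) : ℤˣ) : ℤ) : R) •
        (((Int.negOnePow (cubeL1 v u * (cubeL1 w v - 1) + 1) : ℤˣ) : ℤ) : R) •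
          ((m v u).comp (m w v)) := by
  have hwu : cubeL1 w u = cubeL1 w v + cubeL1 v u := by
    rw [cubeL1_eq_sub_of_le huv, cubeL1_eq_sub_of_le hvw, cubeL1_eq_sub_of_le (huv.trans hvw)]
    ring
  have hw : cubeSum w = cubeL1 w v + cubeSum v := by
    rw [cubeL1_eq_sub_of_le hvw]
    ring
  simp only [cubeF, LinearMap.smul_comp, LinearMap.comp_smul, smul_smul, ← Int.cast_mul,
    ← Units.val_mul, ← Int.negOnePow_add]
  congr 3
  rw [Int.negOnePow_eq_iff, hwu, hw, Int.triangular_add]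
  generalize cubeL1 w v = a
  generalize cubeL1 v u = b
  exact ⟨cubeSum v - a * b, by ring⟩

theorem cubeTotal_lof {R : Type*} [CommRing R] {c : ℕ} {C : (Fin c → Fin 2) → Type*}
    [∀ v, AddCommGroup (C v)] [∀ v, Module R (C v)]
    (m : ∀ v u : Fin c → Fin 2, C v →ₗ[R] C u) (w : Fin c → Fin 2) (x : C w) :
    cubeTotal m (DirectSum.lof R _ C w x) =
      ∑ v, if v ≤ w then DirectSum.lof R _ C v (cubeF m w v x) else 0 := by
  rw [cubeTotal, LinearMap.sum_apply, Finset.sum_filter, Fintype.sum_prod_type,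
    Finset.sum_eq_single w]
  · simp [DirectSum.component.lof_self]
  · intro v _ hv
    simp [DirectSum.component.of, hv.symm]
  · simp

/-- Given `R`-linear maps `m_{vu} : C_v → C_u` for all pairs `v ≥ u` in the cube
`{0,1}^c` satisfying `Σ_{w ≥ v ≥ u} (−1)^{|v−u|₁(|w−v|₁−1)+1} m_{vu} ∘ m_{wv} = 0`, the maps
`f_{vu} := (−1)^{|v−u|₁(|v−u|₁−1)/2 + Σᵢ vᵢ} m_{vu}` satisfy `Σ_{w ≥ v ≥ u} f_{vu} ∘ f_{wv} = 0`;
consequently the total endomorphism `F` of `⊕_v C_v` satisfies `F ∘ F = 0`. -/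
theorem cube_is_chain_complex (R : Type*) [CommRing R] (c : ℕ)
    (C : (Fin c → Fin 2) → Type*)
    [∀ v, AddCommGroup (C v)] [∀ v, Module R (C v)]
    (m : ∀ v u : Fin c → Fin 2, C v →ₗ[R] C u)
    (hm : ∀ w u : Fin c → Fin 2, u ≤ w →
      (∑ v ∈ univ.filter (fun v : Fin c → Fin 2 => u ≤ v ∧ v ≤ w),
        (((Int.negOnePow (cubeL1 v u * (cubeL1 w v - 1) + 1) : ℤˣ) : ℤ) : R) •
          ((m v u).comp (m w v))) = 0) :
    (∀ w u : Fin c → Fin 2, u ≤ w →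
      (∑ v ∈ univ.filter (fun v : Fin c → Fin 2 => u ≤ v ∧ v ≤ w),
        (cubeF m v u).comp (cubeF m w v)) = 0) ∧
    (cubeTotal m).comp (cubeTotal m) = 0 := by
  have hF : ∀ w u : Fin c → Fin 2, u ≤ w →
      (∑ v ∈ univ.filter (fun v : Fin c → Fin 2 => u ≤ v ∧ v ≤ w),
        (cubeF m v u).comp (cubeF m w v)) = 0 := by
    intro w u huw
    rw [Finset.sum_congr rfl fun v hv =>
        cubeF_comp_cubeF m (Finset.mem_filter.mp hv).2.1 (Finset.mem_filter.mp hv).2.2,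
      ← Finset.smul_sum, hm w u huw, smul_zero]
  refine ⟨hF, DirectSum.linearMap_ext R fun w => LinearMap.ext fun x => ?_⟩
  have hterm (v : Fin c → Fin 2) :
      cubeTotal m (if v ≤ w then DirectSum.lof R _ C v (cubeF m w v x) else 0) =
        ∑ u, if u ≤ v ∧ v ≤ w then DirectSum.lof R _ C u (cubeF m v u (cubeF m w v x))
          else 0 := by
    by_cases hvw : v ≤ w <;> simp [hvw, cubeTotal_lof]
  simp only [LinearMap.comp_apply, LinearMap.zero_apply, cubeTotal_lof m w, map_sum, hterm]
  rw [Finset.sum_comm]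
  refine Finset.sum_eq_zero fun u _ => ?_
  rw [← Finset.sum_filter, ← map_sum]
  by_cases huw : u ≤ w
  · have h := LinearMap.congr_fun (hF w u huw) x
    simp only [LinearMap.sum_apply, LinearMap.comp_apply, LinearMap.zero_apply] at h
    rw [h, map_zero]
  · rw [Finset.sum_eq_zero, map_zero]
    intro v hv
    exact absurd ((Finset.mem_filter.mp hv).2.1.trans (Finset.mem_filter.mp hv).2.2) huw
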